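/- Let Γ be a distance-regular graph with classical parameters (D, b, α, β) such that b ≥ 2 and D ≥ 3, let r = [D], and let s be a positive integer such that Γ has the SPLS(s) property. Then s ≥ r, α is an integer with 0 ≤ α ≤ b, and β is a positive integer. -/

import Mathlib

open SimpleGraph

namespace DRGPaper

variable {V : Type*}

/-- `Γ` is a distance-regular graph with diameter `D` and intersection arrays `cc`, `aa`, `bb`:
`Γ` is connected of diameter `D` and for any vertices `x, y` at distance `i ≤ D`, `y` has exactly
`cc i` neighbours at distance `i - 1` from `x`, `aa i` neighbours at distance `i` from `x`,
and `bb i` neighbours at distance `i + 1` from `x`. -/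
def IsDRG [Fintype V] (G : SimpleGraph V) (D : ℕ) (cc aa bb : ℕ → ℕ) : Prop :=
  G.Connected ∧
  (∀ x y : V, G.dist x y ≤ D) ∧
  (∃ x y : V, G.dist x y = D) ∧
  ∀ i : ℕ, i ≤ D → ∀ x y : V, G.dist x y = i →
    {z : V | G.Adj y z ∧ G.dist x z = i - 1}.ncard = cc i ∧
    {z : V | G.Adj y z ∧ G.dist x z = i}.ncard = aa i ∧
    {z : V | G.Adj y z ∧ G.dist x z = i + 1}.ncard = bb i

/-- `[j] = (b^j - 1)/(b - 1) = 1 + b + ⋯ + b^(j-1)` as a real number. -/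
def gauss (b j : ℕ) : ℝ := ∑ i ∈ Finset.range j, (b : ℝ) ^ i

/-- `Γ` has classical parameters `(D, b, α, β)`: it is distance-regular of diameter `D` with
`bb i = ([D] - [i])(β - α[i])` for `0 ≤ i ≤ D - 1` and `cc i = [i](1 + α[i-1])` for
`1 ≤ i ≤ D`. -/
def HasClassicalParams [Fintype V] (G : SimpleGraph V) (D b : ℕ) (α β : ℝ)
    (cc aa bb : ℕ → ℕ) : Prop :=
  IsDRG G D cc aa bb ∧
  (∀ i : ℕ, i ≤ D - 1 → (bb i : ℝ) = (gauss b D - gauss b i) * (β - α * gauss b i)) ∧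
  (∀ i : ℕ, 1 ≤ i → i ≤ D → (cc i : ℝ) = gauss b i * (1 + α * gauss b (i - 1)))

/-- `d(x, C) = min {d(x, y) : y ∈ C}`. -/
noncomputable def distToSet (G : SimpleGraph V) (x : V) (C : Set V) : ℕ :=
  sInf (G.dist x '' C)

/-- A maximal clique of `G`. -/
def IsMaxClique (G : SimpleGraph V) (s : Set V) : Prop :=
  G.IsClique s ∧ ∀ t : Set V, G.IsClique t → s ⊆ t → t = s

/-- The lines for the PLS(γ) property: maximal cliques with at least `γ` vertices. -/
def plsLines (G : SimpleGraph V) (γ : ℕ) : Set (Set V) :=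
  {ℓ : Set V | IsMaxClique G ℓ ∧ γ ≤ ℓ.ncard}

/-- `G` is the point graph of the partial linear space with line set `L`: any two adjacent
vertices lie on exactly one common line of `L`. -/
def IsPointGraphOf (G : SimpleGraph V) (L : Set (Set V)) : Prop :=
  ∀ x y : V, G.Adj x y → ∃! ℓ : Set V, ℓ ∈ L ∧ x ∈ ℓ ∧ y ∈ ℓ

/-- A vertex is a Delsarte vertex (w.r.t. the line set `L` and classical parameter `β`) if all
lines through it have exactly `β + 1` vertices. -/
def IsDelsarteVertex (L : Set (Set V)) (β : ℝ) (x : V) : Prop :=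
  ∀ ℓ ∈ L, x ∈ ℓ → (ℓ.ncard : ℝ) = β + 1

/-- The lines for the SPLS(c, s) property: maximal cliques with at least
`a1 + 2 - (c - 1)(s - 1)` vertices. -/
def splsLines (G : SimpleGraph V) (a1 c s : ℕ) : Set (Set V) :=
  {ℓ : Set V | IsMaxClique G ℓ ∧ (a1 : ℤ) + 2 - ((c : ℤ) - 1) * ((s : ℤ) - 1) ≤ (ℓ.ncard : ℤ)}

/-- The SPLS(c, s) property: `G` is the point graph of the partial linear space whose lines are
the maximal cliques with at least `a1 + 2 - (c-1)(s-1)` vertices, `a1 ≥ (2s-1)(c-1)`, each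
vertex lies on at most `s` lines, and every point not on a line `ℓ` is collinear with at most
`c` points of `ℓ`.  SPLS(s) is the case `c = c₂`. -/
def HasSPLS (G : SimpleGraph V) (a1 c s : ℕ) : Prop :=
  1 ≤ c ∧ 2 ≤ s ∧
  (2 * (s : ℤ) - 1) * ((c : ℤ) - 1) ≤ (a1 : ℤ) ∧
  IsPointGraphOf G (splsLines G a1 c s) ∧
  (∀ x : V, {ℓ ∈ splsLines G a1 c s | x ∈ ℓ}.ncard ≤ s) ∧
  (∀ ℓ ∈ splsLines G a1 c s, ∀ x : V, x ∉ ℓ → {y ∈ ℓ | G.Adj x y}.ncard ≤ c)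

/-- `[x, y]`: the set of lines `ℓ ∈ L` through `x` such that `d(y, u) ≤ 2` for all `u ∈ ℓ`. -/
def lineXY (G : SimpleGraph V) (L : Set (Set V)) (x y : V) : Set (Set V) :=
  {ℓ ∈ L | x ∈ ℓ ∧ ∀ u ∈ ℓ, G.dist y u ≤ 2}

/-- `𝓒` witnesses that `G` is geometric with cliques of order `q`: every member of `𝓒` is a
clique with exactly `q` vertices and every edge of `G` lies in a unique member of `𝓒`. -/
def IsGeomLineSet (G : SimpleGraph V) (q : ℝ) (𝓒 : Set (Set V)) : Prop :=
  (∀ C ∈ 𝓒, G.IsClique C ∧ (C.ncard : ℝ) = q) ∧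
  ∀ x y : V, G.Adj x y → ∃! C : Set V, C ∈ 𝓒 ∧ x ∈ C ∧ y ∈ C

/-- `G` is geometric: there is a set of Delsarte cliques (cliques of the maximum order `q`)
such that every edge lies in a unique member. -/
def IsGeometric (G : SimpleGraph V) (q : ℝ) : Prop :=
  ∃ 𝓒 : Set (Set V), IsGeomLineSet G q 𝓒

/-- An assembly: a maximal clique which is not a line. -/
def IsAssembly (G : SimpleGraph V) (𝓒 : Set (Set V)) (M : Set V) : Prop :=
  IsMaxClique G M ∧ M ∉ 𝓒

/-- The dual Pasch axiom: for every pair of adjacent vertices `x, y`, the common neighbours of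
`x` and `y` outside the (any) line of `𝓒` through `x` and `y` form a clique. -/
def DualPasch (G : SimpleGraph V) (𝓒 : Set (Set V)) : Prop :=
  ∀ x y : V, G.Adj x y → ∀ ℓ ∈ 𝓒, x ∈ ℓ → y ∈ ℓ →
    G.IsClique {z : V | G.Adj x z ∧ G.Adj y z ∧ z ∉ ℓ}

/-- The `m × n` grid, i.e. the Cartesian product `K_m □ K_n`. -/
def gridGraph (m n : ℕ) : SimpleGraph (Fin m × Fin n) :=
  (⊤ : SimpleGraph (Fin m)).boxProd (⊤ : SimpleGraph (Fin n))

/-- The `A`-clique extension of a graph `H`: replace every vertex of `H` by a clique of size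
`A`, vertices in distinct cliques being adjacent exactly when the underlying vertices of `H`
are adjacent. -/
def cliqueExt {W : Type*} (H : SimpleGraph W) (A : ℕ) : SimpleGraph (W × Fin A) :=
  SimpleGraph.fromRel (fun p q => H.Adj p.1 q.1 ∨ p.1 = q.1)

/-- `θ` is an eigenvalue of the adjacency matrix of `G`. -/
def IsAdjEigenvalue [Fintype V] (G : SimpleGraph V) [DecidableRel G.Adj] (θ : ℝ) : Prop :=
  ∃ v : V → ℝ, v ≠ 0 ∧ (G.adjMatrix ℝ).mulVec v = θ • v

section Spectral

open scoped Classical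

theorem exists_adj_dist_eq {G : SimpleGraph V} (hG : G.Connected) {x y : V} {i : ℕ} (h : G.dist x y = i + 1) :
    ∃ z, G.Adj y z ∧ G.dist x z = i := by
  obtain ⟨p, hp⟩ := hG.exists_walk_length_eq_dist y x
  rw [dist_comm, h] at hp
  cases p with
  | nil => simp at hp
  | cons hadj q =>
    rename_i z
    refine ⟨z, hadj, ?_⟩
    have h1 := dist_le q
    have h2 := hG.dist_triangle (u := x) (v := z) (w := y)
    rw [dist_eq_one_iff_adj.2 hadj.symm, h] at h2
    rw [dist_comm] at h1
    rw [Walk.length_cons] at hp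
    omega

variable [Fintype V] {G : SimpleGraph V} {D b : ℕ} {α β : ℝ} {cc aa bb : ℕ → ℕ}

theorem ncard_setOf_eq_sum (p : V → Prop) :
    (({z | p z} : Set V).ncard : ℝ) = ∑ z, if p z then (1 : ℝ) else 0 := by
  rw [Set.ncard_eq_toFinset_card']
  simp

namespace IsDRG

theorem exists_dist_eq (h : IsDRG G D cc aa bb) {i : ℕ} (hi : i ≤ D) :
    ∃ x y, G.dist x y = i := by
  induction hi using Nat.decreasingInduction with
  | self => exact h.2.2.1
  | of_succ k hk ih =>
    obtain ⟨x, y, hxy⟩ := ih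
    obtain ⟨z, -, hz⟩ := exists_adj_dist_eq h.1 hxy
    exact ⟨x, z, hz⟩

theorem cc_pos (h : IsDRG G D cc aa bb) {i : ℕ} (hi : i + 1 ≤ D) : 0 < cc (i + 1) := by
  obtain ⟨x, y, hxy⟩ := h.exists_dist_eq hi
  obtain ⟨z, hz⟩ := exists_adj_dist_eq h.1 hxy
  rw [← (h.2.2.2 _ hi x y hxy).1, Set.ncard_pos]
  exact ⟨z, by simpa using hz⟩

theorem bb_pos (h : IsDRG G D cc aa bb) {i : ℕ} (hi : i + 1 ≤ D) : 0 < bb i := by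
  obtain ⟨x, y, hxy⟩ := h.exists_dist_eq hi
  obtain ⟨z, hz⟩ := exists_adj_dist_eq h.1 hxy
  rw [← (h.2.2.2 _ (by omega) x z hz.2).2.2, Set.ncard_pos]
  exact ⟨y, hz.1.symm, hxy⟩

theorem cc_zero (h : IsDRG G D cc aa bb) : cc 0 = 0 := by
  obtain ⟨x, -⟩ := h.2.2.1
  rw [← (h.2.2.2 0 (by omega) x x dist_self).1, Set.ncard_eq_zero]
  ext z
  simp only [zero_tsub, Set.mem_ofPred_eq, Set.mem_empty_iff_false, iff_false, not_and]
  intro hz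
  rw [dist_eq_one_iff_adj.2 hz]
  omega

theorem aa_zero (h : IsDRG G D cc aa bb) : aa 0 = 0 := by
  obtain ⟨x, -⟩ := h.2.2.1
  obtain ⟨hc, ha, -⟩ := h.2.2.2 0 (by omega) x x dist_self
  exact ha.symm.trans (hc.trans h.cc_zero)

theorem bb_diam (h : IsDRG G D cc aa bb) : bb D = 0 := by
  obtain ⟨x, y, hxy⟩ := h.2.2.1
  rw [← (h.2.2.2 D le_rfl x y hxy).2.2, Set.ncard_eq_zero]
  ext z
  have := h.2.1 x z
  simp only [Set.mem_ofPred_eq, Set.mem_empty_iff_false, iff_false, not_and]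
  omega

/-- The defining counts of a distance-regular graph, summed against a function of the distance. -/
theorem sum_adj_dist (h : IsDRG G D cc aa bb) (u : ℕ → ℝ) (x y : V) :
    (∑ z, if G.Adj y z then u (G.dist x z) else 0) =
      cc (G.dist x y) * u (G.dist x y - 1) + aa (G.dist x y) * u (G.dist x y)
        + bb (G.dist x y) * u (G.dist x y + 1) := by
  obtain ⟨i, hi⟩ : ∃ i, G.dist x y = i := ⟨_, rfl⟩
  obtain ⟨hc, ha, hb⟩ := h.2.2.2 i (hi ▸ h.2.1 x y) x y hi
  rw [hi]
  rcases Nat.eq_zero_or_pos i with rfl | hpos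
  · have hxy : x = y := h.1.dist_eq_zero_iff.1 hi
    subst hxy
    rw [h.cc_zero, h.aa_zero, ← hb, ncard_setOf_eq_sum, Finset.sum_mul]
    simp only [CharP.cast_eq_zero, zero_mul, zero_add]
    refine Finset.sum_congr rfl fun z _ => ?_
    by_cases hz : G.Adj x z
    · simp [hz, dist_eq_one_iff_adj.2 hz]
    · simp [hz]
  · rw [← hc, ← ha, ← hb, ncard_setOf_eq_sum, ncard_setOf_eq_sum, ncard_setOf_eq_sum,
      Finset.sum_mul, Finset.sum_mul, Finset.sum_mul, ← Finset.sum_add_distrib,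
      ← Finset.sum_add_distrib]
    refine Finset.sum_congr rfl fun z _ => ?_
    by_cases hz : G.Adj y z
    · have h1 := h.1.dist_triangle (u := x) (v := y) (w := z)
      have h2 := h.1.dist_triangle (u := x) (v := z) (w := y)
      rw [dist_eq_one_iff_adj.2 hz] at h1
      rw [dist_eq_one_iff_adj.2 hz.symm] at h2
      have h3 : G.dist x z = i - 1 ∨ G.dist x z = i ∨ G.dist x z = i + 1 := by omega
      have e1 : i - 1 ≠ i := by omega
      have e2 : i - 1 ≠ i + 1 := by omega
      rcases h3 with h3 | h3 | h3 <;> simp [hz, h3, e1, e2, e1.symm, e2.symm]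
    · simp [hz]

theorem degree_eq (h : IsDRG G D cc aa bb) (y : V) :
    (∑ z, if G.Adj y z then (1 : ℝ) else 0) = bb 0 := by
  simpa [h.cc_zero, h.aa_zero] using h.sum_adj_dist (fun _ => 1) y y

theorem cc_add_aa_add_bb (h : IsDRG G D cc aa bb) {i : ℕ} (hi : i ≤ D) :
    (cc i + aa i + bb i : ℝ) = bb 0 := by
  obtain ⟨x, y, hxy⟩ := h.exists_dist_eq hi
  have := h.sum_adj_dist (fun _ => 1) x y
  rw [h.degree_eq, hxy] at this
  linarith

end IsDRG

/-- `f` is an eigenfunction of the adjacency operator of `G` with eigenvalue `θ`. -/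
def IsAdjEigenfunction (G : SimpleGraph V) (θ : ℝ) (f : V → ℝ) : Prop :=
  ∀ x, (∑ z, if G.Adj x z then f z else 0) = θ * f x

/-- The sum of `f` over the sphere of radius `i` about `x`. -/
noncomputable def sphereSum (G : SimpleGraph V) (f : V → ℝ) (i : ℕ) (x : V) : ℝ :=
  ∑ z, if G.dist x z = i then f z else 0

theorem IsDRG.sphereSum_zero (h : IsDRG G D cc aa bb) (f : V → ℝ) (x : V) :
    sphereSum G f 0 x = f x := by
  simp [sphereSum, h.1.dist_eq_zero_iff]

theorem IsDRG.sphereSum_of_lt (h : IsDRG G D cc aa bb) (f : V → ℝ) (x : V) {i : ℕ} (hi : D < i) :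
    sphereSum G f i x = 0 := by
  refine Finset.sum_eq_zero fun z _ => if_neg ?_
  have := h.2.1 x z
  omega

theorem IsAdjEigenfunction.mul_sphereSum {θ : ℝ} {f : V → ℝ} (hf : IsAdjEigenfunction G θ f)
    (h : IsDRG G D cc aa bb) (i : ℕ) (x : V) :
    θ * sphereSum G f i x = ∑ y, f y * (cc (G.dist x y) * (if G.dist x y - 1 = i then 1 else 0)
      + aa (G.dist x y) * (if G.dist x y = i then 1 else 0)
      + bb (G.dist x y) * (if G.dist x y + 1 = i then 1 else 0)) := by
  have key : ∀ y, _ := fun y => h.sum_adj_dist (fun j => if j = i then (1 : ℝ) else 0) x y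
  simp only [← key, sphereSum, Finset.mul_sum]
  rw [Finset.sum_comm]
  refine Finset.sum_congr rfl fun z _ => ?_
  by_cases hz : G.dist x z = i
  · simp only [hz, if_true]
    rw [← hf z]
    refine Finset.sum_congr rfl fun y _ => ?_
    simp [G.adj_comm z y]
  · simp [hz]

theorem IsAdjEigenfunction.sphereSum_one {θ : ℝ} {f : V → ℝ} (hf : IsAdjEigenfunction G θ f)
    (h : IsDRG G D cc aa bb) (x : V) :
    θ * sphereSum G f 0 x = cc 1 * sphereSum G f 1 x := by
  rw [hf.mul_sphereSum h, sphereSum, Finset.mul_sum]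
  refine Finset.sum_congr rfl fun y _ => ?_
  rcases hd : G.dist x y with _ | _ | n
  · simp [h.cc_zero, h.aa_zero]
  · simp [mul_comm]
  · simp

theorem IsAdjEigenfunction.sphereSum_add_two {θ : ℝ} {f : V → ℝ} (hf : IsAdjEigenfunction G θ f)
    (h : IsDRG G D cc aa bb) (i : ℕ) (x : V) :
    θ * sphereSum G f (i + 1) x = cc (i + 2) * sphereSum G f (i + 2) x
      + aa (i + 1) * sphereSum G f (i + 1) x + bb i * sphereSum G f i x := by
  rw [hf.mul_sphereSum h]
  simp only [sphereSum, Finset.mul_sum]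
  rw [← Finset.sum_add_distrib, ← Finset.sum_add_distrib]
  refine Finset.sum_congr rfl fun y _ => ?_
  have e1 : G.dist x y - 1 = i + 1 ↔ G.dist x y = i + 2 := by omega
  have e2 : G.dist x y + 1 = i + 1 ↔ G.dist x y = i := by omega
  simp only [e1, e2]
  by_cases h1 : G.dist x y = i + 2
  · simp [h1, mul_comm]
  by_cases h2 : G.dist x y = i + 1
  · simp [h2, mul_comm]
  by_cases h3 : G.dist x y = i
  · simp [h3, mul_comm]
  simp [h1, h2, h3]

theorem gauss_zero : gauss b 0 = 0 := by simp [gauss]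

theorem gauss_one : gauss b 1 = 1 := by simp [gauss]

theorem gauss_two : gauss b 2 = 1 + b := by simp [gauss, Finset.sum_range_succ]

theorem gauss_lt_succ (hb : 2 ≤ b) (i : ℕ) : gauss b i < gauss b (i + 1) := by
  rw [gauss, gauss, Finset.sum_range_succ]
  have : (0 : ℝ) < (b : ℝ) ^ i := by positivity
  linarith

theorem gauss_strictMono (hb : 2 ≤ b) : StrictMono (gauss b) :=
  strictMono_nat_of_lt_succ (gauss_lt_succ hb)

theorem gauss_pos (hb : 2 ≤ b) {i : ℕ} (hi : 0 < i) : 0 < gauss b i := by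
  rw [← gauss_zero (b := b)]
  exact gauss_strictMono hb hi

namespace HasClassicalParams

theorem bb_eq (h : HasClassicalParams G D b α β cc aa bb) {i : ℕ} (hi : i ≤ D) :
    (bb i : ℝ) = (gauss b D - gauss b i) * (β - α * gauss b i) := by
  rcases hi.eq_or_lt with rfl | hlt
  · simp [h.1.bb_diam]
  · exact h.2.1 i (by omega)

theorem cc_eq (h : HasClassicalParams G D b α β cc aa bb) {i : ℕ} (hi : i + 1 ≤ D) :
    (cc (i + 1) : ℝ) = gauss b (i + 1) * (1 + α * gauss b i) :=
  h.2.2 (i + 1) (by omega) hi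

theorem aa_eq (h : HasClassicalParams G D b α β cc aa bb) {i : ℕ} (hi : i + 1 ≤ D) :
    (aa (i + 1) : ℝ) = gauss b D * β - (gauss b D - gauss b (i + 1)) * (β - α * gauss b (i + 1))
      - gauss b (i + 1) * (1 + α * gauss b i) := by
  have h1 := h.1.cc_add_aa_add_bb hi
  rw [h.cc_eq hi, h.bb_eq hi, h.bb_eq (Nat.zero_le _), gauss_zero] at h1
  linarith

theorem one_add_pos (h : HasClassicalParams G D b α β cc aa bb) (hb : 2 ≤ b) {i : ℕ}
    (hi : i + 1 ≤ D) : 0 < 1 + α * gauss b i := by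
  have h1 : (0 : ℝ) < cc (i + 1) := by exact_mod_cast h.1.cc_pos hi
  rw [h.cc_eq hi] at h1
  exact pos_of_mul_pos_right h1 (gauss_pos hb (by omega)).le

theorem beta_sub_pos (h : HasClassicalParams G D b α β cc aa bb) (hb : 2 ≤ b) {i : ℕ}
    (hi : i + 1 ≤ D) : 0 < β - α * gauss b i := by
  have h1 : (0 : ℝ) < bb i := by exact_mod_cast h.1.bb_pos hi
  rw [h.bb_eq (by omega)] at h1
  exact pos_of_mul_pos_right h1 (sub_pos.2 (gauss_strictMono hb (by omega))).le

/-- The alternating sphere sums of an eigenfunction whose eigenvalue is less than `-[D]` grow too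
fast for the recurrence to close up at distance `D`. -/
theorem le_eigenvalue (h : HasClassicalParams G D b α β cc aa bb) (hb : 2 ≤ b) (hD : 1 ≤ D)
    {θ : ℝ} {f : V → ℝ} (hf : IsAdjEigenfunction G θ f) {x : V} (hx : 0 < f x) :
    -gauss b D ≤ θ := by
  by_contra! hθ
  have key : ∀ i, i + 1 ≤ D → 0 < (-1) ^ i * sphereSum G f i x ∧
      (gauss b D - gauss b i) * ((-1) ^ i * sphereSum G f i x) <
        gauss b (i + 1) * ((-1) ^ (i + 1) * sphereSum G f (i + 1) x) := by
    intro i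
    induction i with
    | zero =>
      intro hi
      have h1 := hf.sphereSum_one h.1 x
      have hc := h.cc_eq hi
      rw [h.1.sphereSum_zero] at h1
      simp only [zero_add, gauss_zero, gauss_one, h.1.sphereSum_zero] at *
      refine ⟨by simpa using hx, ?_⟩
      rw [hc] at h1
      nlinarith
    | succ i ih =>
      intro hi
      obtain ⟨h1, h2⟩ := ih (by omega)
      have hrec := hf.sphereSum_add_two h.1 i x
      rw [h.cc_eq hi, h.aa_eq (by omega), h.bb_eq (by omega)] at hrec
      have hp := h.one_add_pos hb (i := i + 1) hi
      have hq := h.beta_sub_pos hb (i := i) (by omega)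
      have hg := gauss_strictMono hb (show i < D by omega)
      have hg1 := gauss_pos hb (show 0 < i + 1 by omega)
      have hpos : 0 < (-1) ^ (i + 1) * sphereSum G f (i + 1) x :=
        pos_of_mul_pos_right ((mul_pos (sub_pos.2 hg) h1).trans h2) hg1.le
      refine ⟨hpos, ?_⟩
      rw [show (-1 : ℝ) ^ (i + 1 + 1) = (-1) ^ i by ring, show i + 1 + 1 = i + 2 from rfl]
      rw [show (-1 : ℝ) ^ (i + 1) = -(-1) ^ i by ring] at hpos h2 ⊢
      rcases neg_one_pow_eq_or ℝ i with e | e <;> rw [e] at hpos h1 h2 ⊢ <;>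
        refine lt_of_mul_lt_mul_left ?_ hp.le <;>
        nlinarith [mul_lt_mul_of_pos_left h2 hq, mul_lt_mul_of_pos_right hθ hpos]
  obtain ⟨d, rfl⟩ : ∃ d, D = d + 1 := ⟨D - 1, by omega⟩
  obtain ⟨h1, h2⟩ := key d le_rfl
  have hrec := hf.sphereSum_add_two h.1 d x
  rw [h.1.sphereSum_of_lt f x (show d + 1 < d + 2 by omega), h.aa_eq le_rfl,
    h.bb_eq (by omega)] at hrec
  have hq := h.beta_sub_pos hb (i := d) le_rfl
  have hg := gauss_lt_succ hb d
  have hg1 := gauss_pos hb (show 0 < d + 1 by omega)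
  have hpos : 0 < (-1) ^ (d + 1) * sphereSum G f (d + 1) x :=
    pos_of_mul_pos_right ((mul_pos (sub_pos.2 hg) h1).trans h2) hg1.le
  rw [show (-1 : ℝ) ^ (d + 1) = -(-1) ^ d by ring] at hpos h2
  rcases neg_one_pow_eq_or ℝ d with e | e <;> rw [e] at hpos h1 h2 <;>
    nlinarith [mul_lt_mul_of_pos_left h2 hq, mul_lt_mul_of_pos_right hθ hpos]

/-- The adjacency form plus `[D]` times the identity form is positive semidefinite. -/
theorem form_nonneg (h : HasClassicalParams G D b α β cc aa bb) (hb : 2 ≤ b) (hD : 1 ≤ D)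
    (g : V → ℝ) :
    0 ≤ (∑ x, ∑ y, if G.Adj x y then g x * g y else 0) + gauss b D * ∑ x, g x ^ 2 := by
  set B : Matrix V V ℝ := G.adjMatrix ℝ + gauss b D • 1 with hB
  have hH : B.IsHermitian := by
    rw [Matrix.IsHermitian, Matrix.conjTranspose_eq_transpose_of_trivial, hB]
    simp
  have hmul : ∀ (f : V → ℝ) (x : V),
      (B.mulVec f) x = (∑ z, if G.Adj x z then f z else 0) + gauss b D * f x := by
    intro f x
    rw [hB, Matrix.add_mulVec, Matrix.smul_mulVec, Matrix.one_mulVec]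
    simp [Matrix.mulVec, dotProduct, adjMatrix_apply]
  have hpsd : B.PosSemidef := by
    refine hH.posSemidef_iff_eigenvalues_nonneg.2 fun j => ?_
    set f : V → ℝ := WithLp.ofLp (hH.eigenvectorBasis j)
    have hBf : B.mulVec f = hH.eigenvalues j • f := hH.mulVec_eigenvectorBasis j
    have hne : f ≠ 0 := by
      intro h0
      have := hH.eigenvectorBasis.orthonormal.ne_zero j
      exact this (by ext i; exact congrFun h0 i)
    obtain ⟨x, hx⟩ := Function.ne_iff.1 hne
    have hf : IsAdjEigenfunction G (hH.eigenvalues j - gauss b D) f := by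
      intro x
      have := congrFun hBf x
      rw [hmul, Pi.smul_apply, smul_eq_mul] at this
      linarith
    rcases lt_or_gt_of_ne hx with hx | hx
    · have hf' : IsAdjEigenfunction G (hH.eigenvalues j - gauss b D) (-f) := by
        intro y
        have := hf y
        simp only [Pi.neg_apply, mul_neg, ← this, ← Finset.sum_neg_distrib]
        refine Finset.sum_congr rfl fun z _ => ?_
        split_ifs <;> simp
      have := h.le_eigenvalue hb hD hf' (x := x) (by simpa using hx)
      simp; linarith
    · have := h.le_eigenvalue hb hD hf (x := x) (by simpa using hx)
      simp; linarith
  have := hpsd.dotProduct_mulVec_nonneg g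
  simp only [dotProduct, hmul, star_trivial] at this
  refine this.trans_eq ?_
  rw [Finset.mul_sum, ← Finset.sum_add_distrib]
  refine Finset.sum_congr rfl fun x _ => ?_
  rw [mul_add, Finset.mul_sum]
  congr 1
  · refine Finset.sum_congr rfl fun y _ => ?_
    split_ifs <;> simp
  · ring

theorem sphereSum_succ (h : HasClassicalParams G D b α β cc aa bb) (hb : 2 ≤ b)
    {f : V → ℝ} (hf : IsAdjEigenfunction G (-gauss b D) f) (x : V) {i : ℕ} (hi : i + 1 ≤ D) :
    gauss b (i + 1) * sphereSum G f (i + 1) x =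
      -(gauss b D - gauss b i) * sphereSum G f i x := by
  induction i with
  | zero =>
    have h1 := hf.sphereSum_one h.1 x
    have hc := h.cc_eq hi
    simp only [zero_add, gauss_zero, gauss_one] at *
    rw [hc] at h1
    linarith
  | succ i ih =>
    have h2 := ih (by omega)
    have hrec := hf.sphereSum_add_two h.1 i x
    rw [h.cc_eq hi, h.aa_eq (by omega), h.bb_eq (by omega)] at hrec
    have hp := h.one_add_pos hb (i := i + 1) hi
    refine mul_left_cancel₀ hp.ne' ?_
    linear_combination -hrec - (β - α * gauss b i) * h2

/-- Eigenvalue of the distance-`i` operator on the eigenspace of the eigenvalue `-[D]`. -/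
noncomputable def sphereEigenvalue (D b i : ℕ) : ℝ :=
  ∏ j ∈ Finset.range i, -(gauss b D - gauss b j) / gauss b (j + 1)

theorem sphereSum_eq (h : HasClassicalParams G D b α β cc aa bb) (hb : 2 ≤ b)
    {f : V → ℝ} (hf : IsAdjEigenfunction G (-gauss b D) f) (x : V) {i : ℕ} (hi : i ≤ D) :
    sphereSum G f i x = sphereEigenvalue D b i * f x := by
  induction i with
  | zero => simp [sphereEigenvalue, h.1.sphereSum_zero]
  | succ i ih =>
    have hg := gauss_pos hb (show 0 < i + 1 by omega)
    have h1 := h.sphereSum_succ hb hf x hi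
    rw [ih (by omega)] at h1
    rw [sphereEigenvalue, Finset.prod_range_succ, ← sphereEigenvalue]
    field_simp
    linarith

/-- The standard sequence of the eigenvalue `-[D]`. -/
noncomputable def cosine (b : ℕ) (α β : ℝ) (i : ℕ) : ℝ :=
  ∏ j ∈ Finset.range i, -(1 + α * gauss b j) / (β - α * gauss b j)

theorem cosine_zero : cosine b α β 0 = 1 := by simp [cosine]

theorem cosine_succ (h : HasClassicalParams G D b α β cc aa bb) (hb : 2 ≤ b) {i : ℕ}
    (hi : i + 1 ≤ D) :
    (β - α * gauss b i) * cosine b α β (i + 1) = -(1 + α * gauss b i) * cosine b α β i := by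
  have hq := h.beta_sub_pos hb hi
  rw [cosine, Finset.prod_range_succ, ← cosine]
  field_simp

theorem isAdjEigenfunction_cosine (h : HasClassicalParams G D b α β cc aa bb) (hb : 2 ≤ b)
    (hD : 1 ≤ D) (y : V) :
    IsAdjEigenfunction G (-gauss b D) fun x => cosine b α β (G.dist y x) := by
  intro x
  rw [h.1.sum_adj_dist (cosine b α β) y x]
  beta_reduce
  have hd := h.1.2.1 y x
  rcases hi : G.dist y x with _ | i
  · have h1 := h.cosine_succ hb (i := 0) hD
    rw [h.1.cc_zero, h.1.aa_zero, h.bb_eq (Nat.zero_le _)]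
    simp only [gauss_zero, cosine_zero, zero_add, mul_zero, sub_zero, add_zero] at *
    push_cast
    linear_combination gauss b D * h1
  · rw [hi] at hd
    have h1 := h.cosine_succ hb (i := i) hd
    rw [h.cc_eq hd, h.aa_eq hd, h.bb_eq hd, Nat.add_sub_cancel]
    rcases hd.eq_or_lt with he | hlt
    · subst he
      linear_combination gauss b (i + 1) * h1
    · have h2 := h.cosine_succ hb (i := i + 1) hlt
      linear_combination gauss b (i + 1) * h1 + (gauss b D - gauss b (i + 1)) * h2

/-- The matrix of cosines is a positive multiple of an idempotent. -/
theorem exists_sum_cosine_mul_cosine (h : HasClassicalParams G D b α β cc aa bb) (hb : 2 ≤ b)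
    (hD : 1 ≤ D) :
    ∃ m : ℝ, 0 < m ∧ ∀ x y : V, ∑ z, cosine b α β (G.dist x z) * cosine b α β (G.dist y z) =
      m * cosine b α β (G.dist x y) := by
  set m : ℝ := ∑ i ∈ Finset.range (D + 1), cosine b α β i * sphereEigenvalue D b i
  have key : ∀ x y : V, ∑ z, cosine b α β (G.dist x z) * cosine b α β (G.dist y z) =
      m * cosine b α β (G.dist x y) := by
    intro x y
    have hf := h.isAdjEigenfunction_cosine hb hD y
    calc ∑ z, cosine b α β (G.dist x z) * cosine b α β (G.dist y z)
        = ∑ i ∈ Finset.range (D + 1),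
            cosine b α β i * sphereSum G (fun z => cosine b α β (G.dist y z)) i x := by
          simp only [sphereSum, Finset.mul_sum]
          rw [Finset.sum_comm]
          refine Finset.sum_congr rfl fun z _ => ?_
          rw [Finset.sum_eq_single (G.dist x z)]
          · simp
          · intro i _ hi
            simp [hi.symm]
          · intro hn
            have := h.1.2.1 x z
            simp at hn
            omega
      _ = m * cosine b α β (G.dist x y) := by
          rw [Finset.sum_mul]
          refine Finset.sum_congr rfl fun i hi => ?_
          rw [h.sphereSum_eq hb hf x (by simp at hi; omega), dist_comm (u := y)]
          ring
  refine ⟨m, ?_, key⟩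
  obtain ⟨x, -⟩ := h.1.2.2.1
  have h1 := key x x
  rw [dist_self, cosine_zero, mul_one] at h1
  rw [← h1]
  refine Finset.sum_pos' (fun z _ => mul_self_nonneg _) ⟨x, Finset.mem_univ _, ?_⟩
  simp [cosine_zero]

theorem beta_pos (h : HasClassicalParams G D b α β cc aa bb) (hb : 2 ≤ b) (hD : 1 ≤ D) :
    0 < β := by
  simpa [gauss_zero] using h.beta_sub_pos hb (i := 0) hD

theorem cosine_one (h : HasClassicalParams G D b α β cc aa bb) (hb : 2 ≤ b) (hD : 1 ≤ D) :
    β * cosine b α β 1 = -1 := by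
  simpa [gauss_zero, cosine_zero] using h.cosine_succ hb (i := 0) hD

theorem exists_sum_sq_clique (h : HasClassicalParams G D b α β cc aa bb) (hb : 2 ≤ b)
    (hD : 1 ≤ D) :
    ∃ m : ℝ, 0 < m ∧ ∀ C : Finset V, G.IsClique (C : Set V) →
      ∑ z, (∑ y ∈ C, cosine b α β (G.dist y z)) ^ 2 = m * (C.card * (β + 1 - C.card)) := by
  obtain ⟨m, hm, key⟩ := h.exists_sum_cosine_mul_cosine hb hD
  have hβ := h.beta_pos hb hD
  have h1 := h.cosine_one hb hD
  refine ⟨m / β, by positivity, fun C hC => ?_⟩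
  have hinner : ∀ y ∈ C, ∑ y' ∈ C, m * cosine b α β (G.dist y y') =
      m / β * (β + 1 - C.card) := by
    intro y hy
    rw [← Finset.mul_sum, ← Finset.add_sum_erase _ _ hy, dist_self, cosine_zero]
    rw [Finset.sum_congr rfl (g := fun _ => cosine b α β 1)]
    · rw [Finset.sum_const, Finset.card_erase_of_mem hy, nsmul_eq_mul,
        Nat.cast_sub (Finset.card_pos.2 ⟨y, hy⟩)]
      field_simp
      push_cast
      linear_combination (C.card - 1 : ℝ) * h1
    · intro y' hy'
      rw [Finset.mem_erase] at hy'
      rw [dist_eq_one_iff_adj.2 (hC hy hy'.2 hy'.1.symm)]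
  calc ∑ z, (∑ y ∈ C, cosine b α β (G.dist y z)) ^ 2
      = ∑ y ∈ C, ∑ y' ∈ C, ∑ z, cosine b α β (G.dist y z) * cosine b α β (G.dist y' z) := by
        simp_rw [sq, Finset.sum_mul_sum]
        rw [Finset.sum_comm]
        refine Finset.sum_congr rfl fun y _ => Finset.sum_comm
    _ = m / β * (C.card * (β + 1 - C.card)) := by
        simp_rw [key]
        rw [Finset.sum_congr rfl hinner, Finset.sum_const, nsmul_eq_mul]
        ring

theorem card_clique_le (h : HasClassicalParams G D b α β cc aa bb) (hb : 2 ≤ b) (hD : 1 ≤ D)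
    {C : Finset V} (hC : G.IsClique (C : Set V)) : (C.card : ℝ) ≤ β + 1 := by
  obtain ⟨m, hm, key⟩ := h.exists_sum_sq_clique hb hD
  have h1 := key C hC
  have h2 : 0 ≤ m * (C.card * (β + 1 - C.card)) := h1 ▸ Finset.sum_nonneg fun z _ => sq_nonneg _
  have hβ := h.beta_pos hb hD
  rcases C.card.eq_zero_or_pos with h0 | h0
  · rw [h0]
    push_cast
    linarith
  · have := nonneg_of_mul_nonneg_right (nonneg_of_mul_nonneg_right h2 hm)
      (Nat.cast_pos.2 h0)
    linarith

/-- A vertex at distance one from a clique attaining the Delsarte bound has exactly `1 + α`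
neighbours in it. -/
theorem card_adj_delsarte (h : HasClassicalParams G D b α β cc aa bb) (hb : 2 ≤ b) (hD : 2 ≤ D)
    {C : Finset V} (hC : G.IsClique (C : Set V)) (hcard : (C.card : ℝ) = β + 1) {x : V}
    (hx : x ∉ C) (hadj : ∃ y ∈ C, G.Adj x y) :
    ((C.filter fun y => G.Adj x y).card : ℝ) = 1 + α := by
  obtain ⟨m, hm, key⟩ := h.exists_sum_sq_clique hb (by omega)
  have h1 := key C hC
  rw [hcard, sub_self, mul_zero, mul_zero,
    Finset.sum_eq_zero_iff_of_nonneg fun z _ => sq_nonneg _] at h1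
  have h2 := pow_eq_zero_iff (two_ne_zero) |>.1 (h1 x (Finset.mem_univ _))
  have hdist : ∀ y ∈ C, ¬ G.Adj x y → G.dist y x = 2 := by
    intro y hy hn
    obtain ⟨w, hw, hxw⟩ := hadj
    have hyx : y ≠ x := fun e => hx (e ▸ hy)
    have h3 := h.1.1.one_lt_dist_of_ne_of_not_adj hyx fun e => hn e.symm
    have hyw : y ≠ w := fun e => hn (e ▸ hxw)
    have h4 := h.1.1.dist_triangle (u := y) (v := w) (w := x)
    rw [dist_eq_one_iff_adj.2 (hC hy hw hyw), dist_eq_one_iff_adj.2 hxw.symm] at h4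
    omega
  rw [← Finset.sum_filter_add_sum_filter_not C (fun y => G.Adj x y),
    Finset.sum_congr rfl (g := fun _ => cosine b α β 1) (s₂ := C.filter fun y => G.Adj x y),
    Finset.sum_congr rfl (g := fun _ => cosine b α β 2) (s₂ := C.filter fun y => ¬ G.Adj x y),
    Finset.sum_const, Finset.sum_const, nsmul_eq_mul, nsmul_eq_mul] at h2
  · have h3 : ((C.filter fun y => G.Adj x y).card : ℝ)
        + (C.filter fun y => ¬ G.Adj x y).card = β + 1 := by
      rw [← hcard]
      exact_mod_cast Finset.card_filter_add_card_filter_not (s := C) (fun y => G.Adj x y)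
    have h4 := h.cosine_one hb (by omega)
    have h5 := h.cosine_succ hb (i := 1) hD
    have h6 := h.beta_sub_pos hb (i := 1) hD
    have h7 := h.beta_pos hb (by omega)
    rw [gauss_one, mul_one] at h5 h6
    set p : ℝ := ((C.filter fun y => G.Adj x y).card : ℝ)
    set q : ℝ := ((C.filter fun y => ¬ G.Adj x y).card : ℝ)
    have h8 : (β + 1) * (p - (1 + α)) = 0 := by
      linear_combination (-(β * (β - α))) * h2 + p * (β - α) * h4 + q * β * h5
        - q * (1 + α) * h4 + (1 + α) * h3
    have := (mul_eq_zero.1 h8).resolve_left (by linarith)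
    linarith
  · intro y hy
    rw [Finset.mem_filter] at hy
    rw [hdist y hy.1 hy.2]
  · intro y hy
    rw [Finset.mem_filter] at hy
    rw [dist_eq_one_iff_adj.2 hy.2.symm]

end HasClassicalParams

end Spectral

section Lines

open scoped Classical

/-- The vertices and the members of `L` form a partial linear space with point graph `G`. -/
structure IsLineFamily (G : SimpleGraph V) (L : Finset (Finset V)) : Prop where
  isClique : ∀ ℓ ∈ L, G.IsClique (ℓ : Set V)
  existsUnique : ∀ x y, G.Adj x y → ∃! ℓ, ℓ ∈ L ∧ x ∈ ℓ ∧ y ∈ ℓ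

variable {G : SimpleGraph V} {L : Finset (Finset V)} {D b s : ℕ} {α β : ℝ} {cc aa bb : ℕ → ℕ}

/-- The members of `L` through the point `x`. -/
noncomputable def linesThrough (L : Finset (Finset V)) (x : V) : Finset (Finset V) :=
  L.filter fun ℓ => x ∈ ℓ

theorem mem_linesThrough {x : V} {ℓ : Finset V} : ℓ ∈ linesThrough L x ↔ ℓ ∈ L ∧ x ∈ ℓ :=
  Finset.mem_filter

namespace IsLineFamily

theorem eq_of_mem (hL : IsLineFamily G L) {x y : V} (hxy : x ≠ y) {ℓ ℓ' : Finset V}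
    (hℓ : ℓ ∈ L) (hℓ' : ℓ' ∈ L) (hx : x ∈ ℓ) (hy : y ∈ ℓ) (hx' : x ∈ ℓ') (hy' : y ∈ ℓ') :
    ℓ = ℓ' :=
  (hL.existsUnique x y (hL.isClique ℓ hℓ hx hy hxy)).unique ⟨hℓ, hx, hy⟩ ⟨hℓ', hx', hy'⟩

theorem sum_linesThrough_ite (hL : IsLineFamily G L) {x z : V} (hxz : x ≠ z) (c : ℝ) :
    (∑ ℓ ∈ linesThrough L x, if z ∈ ℓ then c else 0) = if G.Adj x z then c else 0 := by
  split_ifs with hadj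
  · obtain ⟨ℓ, ⟨hℓ, hx, hz⟩, -⟩ := hL.existsUnique x z hadj
    rw [Finset.sum_eq_single ℓ]
    · simp [hz]
    · intro ℓ' hℓ' hne
      rw [mem_linesThrough] at hℓ'
      exact if_neg fun hz' => hne (hL.eq_of_mem hxz hℓ'.1 hℓ hℓ'.2 hz' hx hz)
    · intro hn
      exact absurd (mem_linesThrough.2 ⟨hℓ, hx⟩) hn
  · refine Finset.sum_eq_zero fun ℓ hℓ => if_neg fun hz => hadj ?_
    rw [mem_linesThrough] at hℓ
    exact hL.isClique ℓ hℓ.1 hℓ.2 hz hxz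

variable [Fintype V]

/-- The lines through `x` partition the neighbours of `x`. -/
theorem sum_adj (hL : IsLineFamily G L) (φ : V → ℝ) (x : V) :
    (∑ z, if G.Adj x z then φ z else 0) = ∑ ℓ ∈ linesThrough L x, ∑ z ∈ ℓ.erase x, φ z := by
  have h1 : ∀ ℓ : Finset V, ∑ z ∈ ℓ.erase x, φ z =
      ∑ z ∈ Finset.univ.erase x, if z ∈ ℓ then φ z else 0 := by
    intro ℓ
    rw [← Finset.sum_filter]
    refine Finset.sum_congr ?_ fun _ _ => rfl
    ext z
    simp
  simp only [h1]
  rw [Finset.sum_comm, ← Finset.add_sum_erase _ _ (Finset.mem_univ x)]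
  simp only [G.irrefl, if_false, zero_add]
  refine Finset.sum_congr rfl fun z hz => ?_
  rw [hL.sum_linesThrough_ite (Finset.ne_of_mem_erase hz).symm]

theorem sum_sq_sum (hL : IsLineFamily G L) (g : V → ℝ) :
    ∑ ℓ ∈ L, (∑ x ∈ ℓ, g x) ^ 2 =
      (∑ x, ∑ y, if G.Adj x y then g x * g y else 0)
        + ∑ x, (linesThrough L x).card * g x ^ 2 := by
  have h1 : ∀ ℓ : Finset V, (∑ x ∈ ℓ, g x) ^ 2 =
      ∑ x, if x ∈ ℓ then (g x ^ 2 + ∑ z ∈ ℓ.erase x, g x * g z) else 0 := by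
    intro ℓ
    rw [sq, Finset.sum_mul_sum, ← Finset.sum_filter]
    refine Finset.sum_congr (by ext; simp) fun x hx => ?_
    rw [← Finset.add_sum_erase ℓ _ (by simpa using hx), sq]
  simp only [h1]
  rw [Finset.sum_comm, ← Finset.sum_add_distrib]
  refine Finset.sum_congr rfl fun x _ => ?_
  rw [hL.sum_adj, ← Finset.sum_filter, ← linesThrough, Finset.sum_add_distrib, Finset.sum_const,
    nsmul_eq_mul, add_comm]

theorem sum_card_linesThrough (L : Finset (Finset V)) :
    ∑ x, (linesThrough L x).card = ∑ ℓ ∈ L, ℓ.card := by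
  simp only [linesThrough, Finset.card_filter]
  rw [Finset.sum_comm]
  refine Finset.sum_congr rfl fun ℓ _ => ?_
  simp

theorem sum_card_sub_one (hL : IsLineFamily G L) (h : IsDRG G D cc aa bb) (x : V) :
    ∑ ℓ ∈ linesThrough L x, ((ℓ.card : ℝ) - 1) = bb 0 := by
  rw [← h.degree_eq x, hL.sum_adj]
  refine Finset.sum_congr rfl fun ℓ hℓ => ?_
  have hx := (mem_linesThrough.1 hℓ).2
  rw [Finset.sum_const, Finset.card_erase_of_mem hx, nsmul_eq_mul, mul_one,
    Nat.cast_sub (Finset.card_pos.2 ⟨x, hx⟩), Nat.cast_one]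

theorem gauss_le_card (hL : IsLineFamily G L) (h : HasClassicalParams G D b α β cc aa bb)
    (hb : 2 ≤ b) (hD : 1 ≤ D) (x : V) : gauss b D ≤ (linesThrough L x).card := by
  have h1 := hL.sum_card_sub_one h.1 x
  have hβ := h.beta_pos hb hD
  rw [h.bb_eq (Nat.zero_le _), gauss_zero] at h1
  have h2 : ∑ ℓ ∈ linesThrough L x, ((ℓ.card : ℝ) - 1) ≤ ∑ ℓ ∈ linesThrough L x, β := by
    refine Finset.sum_le_sum fun ℓ hℓ => ?_
    have := h.card_clique_le hb hD (hL.isClique ℓ (mem_linesThrough.1 hℓ).1)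
    linarith
  rw [Finset.sum_const, nsmul_eq_mul] at h2
  refine le_of_mul_le_mul_right ?_ hβ
  linarith

theorem card_eq_of_card_linesThrough_eq (hL : IsLineFamily G L)
    (h : HasClassicalParams G D b α β cc aa bb)
    (hb : 2 ≤ b) (hD : 1 ≤ D) {x : V} (hx : ((linesThrough L x).card : ℝ) = gauss b D)
    {ℓ : Finset V} (hℓ : ℓ ∈ L) (hxℓ : x ∈ ℓ) : (ℓ.card : ℝ) = β + 1 := by
  have h1 := hL.sum_card_sub_one h.1 x
  rw [h.bb_eq (Nat.zero_le _), gauss_zero] at h1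
  have h2 : ∑ ℓ ∈ linesThrough L x, ((ℓ.card : ℝ) - 1) = ∑ ℓ ∈ linesThrough L x, β := by
    rw [h1, Finset.sum_const, nsmul_eq_mul, hx]
    ring
  rw [Finset.sum_eq_sum_iff_of_le] at h2
  · have := h2 ℓ (mem_linesThrough.2 ⟨hℓ, hxℓ⟩)
    linarith
  · intro ℓ hℓ
    have := h.card_clique_le hb hD (hL.isClique ℓ (mem_linesThrough.1 hℓ).1)
    linarith

/-- Functions supported on the points with more than `[D]` lines and summing to zero on every line
vanish, since the point-line incidence form dominates on them. -/
theorem card_le_card_add_card (hL : IsLineFamily G L)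
    (h : HasClassicalParams G D b α β cc aa bb) (hb : 2 ≤ b) (hD : 1 ≤ D) :
    Fintype.card V ≤ L.card +
      (Finset.univ.filter fun x => ((linesThrough L x).card : ℝ) = gauss b D).card := by
  set T := Finset.univ.filter fun x => ((linesThrough L x).card : ℝ) = gauss b D with hT
  let φ : (V → ℝ) →ₗ[ℝ] (L → ℝ) × (T → ℝ) :=
    (LinearMap.pi fun ℓ : L => ∑ x ∈ ℓ.1, LinearMap.proj x).prod
      (LinearMap.pi fun x : T => LinearMap.proj x.1)
  have hφ : Function.Injective φ := by
    rw [← LinearMap.ker_eq_bot, LinearMap.ker_eq_bot']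
    intro g hg
    have h1 : ∀ ℓ ∈ L, ∑ x ∈ ℓ, g x = 0 := by
      intro ℓ hℓ
      have := congrFun (congrArg Prod.fst hg) ⟨ℓ, hℓ⟩
      simpa [φ] using this
    have h2 : ∀ x ∈ T, g x = 0 := by
      intro x hx
      exact congrFun (congrArg Prod.snd hg) ⟨x, hx⟩
    have h3 := hL.sum_sq_sum g
    rw [Finset.sum_eq_zero fun ℓ hℓ => by rw [h1 ℓ hℓ]; simp] at h3
    have h4 := h.form_nonneg hb hD g
    have h5 : ∑ x, ((linesThrough L x).card - gauss b D) * g x ^ 2 ≤ 0 := by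
      simp only [sub_mul, Finset.sum_sub_distrib, ← Finset.mul_sum]
      linarith
    have h6 : ∀ x ∈ Finset.univ, 0 ≤ ((linesThrough L x).card - gauss b D) * g x ^ 2 :=
      fun x _ => mul_nonneg (sub_nonneg.2 (hL.gauss_le_card h hb hD x)) (sq_nonneg _)
    have h7 := (Finset.sum_eq_zero_iff_of_nonneg h6).1 (le_antisymm h5 (Finset.sum_nonneg h6))
    ext x
    by_cases hx : x ∈ T
    · exact h2 x hx
    · have hne : ((linesThrough L x).card : ℝ) - gauss b D ≠ 0 := by
        intro e
        exact hx (by simpa [hT] using sub_eq_zero.1 e)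
      exact pow_eq_zero_iff two_ne_zero |>.1
        ((mul_eq_zero.1 (h7 x (Finset.mem_univ _))).resolve_left hne)
  simpa using LinearMap.finrank_le_finrank_of_injective hφ

/-- If lines are more than twice as long as the number of lines through a point, then there are
two adjacent points lying on exactly `[D]` lines. -/
theorem exists_adj_card_linesThrough_eq (hL : IsLineFamily G L)
    (h : HasClassicalParams G D b α β cc aa bb) (hb : 2 ≤ b) (hD : 1 ≤ D)
    (hs : ∀ x, (linesThrough L x).card ≤ s) (hmin : ∀ ℓ ∈ L, 2 * s < ℓ.card) :
    ∃ x y, G.Adj x y ∧ ((linesThrough L x).card : ℝ) = gauss b D ∧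
      ((linesThrough L y).card : ℝ) = gauss b D := by
  have h1 := hL.card_le_card_add_card h hb hD
  set T := Finset.univ.filter fun x => ((linesThrough L x).card : ℝ) = gauss b D with hT
  have hV : 0 < Fintype.card V := Fintype.card_pos_iff.2 h.1.1.nonempty
  have h2 : L.card * (2 * s + 1) ≤ s * Fintype.card V := by
    calc L.card * (2 * s + 1) ≤ ∑ ℓ ∈ L, ℓ.card := by
          rw [← smul_eq_mul]
          exact Finset.card_nsmul_le_sum _ _ _ hmin
      _ = ∑ x, (linesThrough L x).card := (sum_card_linesThrough L).symm
      _ ≤ s * Fintype.card V := by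
          rw [mul_comm, ← smul_eq_mul]
          exact Finset.sum_le_card_nsmul _ _ _ fun x _ => hs x
  have h3 : 2 * L.card < Fintype.card V := by
    by_contra! hcon
    nlinarith
  by_contra! hcon
  have hk : (0 : ℝ) < bb 0 := by exact_mod_cast h.1.bb_pos hD
  have h4 : (bb 0 : ℝ) * T.card ≤ bb 0 * Tᶜ.card := by
    calc (bb 0 : ℝ) * T.card = ∑ x ∈ T, ∑ y, if G.Adj x y then (1 : ℝ) else 0 := by
          rw [Finset.sum_congr rfl fun x _ => h.1.degree_eq x, Finset.sum_const, nsmul_eq_mul,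
            mul_comm]
      _ = ∑ x ∈ T, ∑ y ∈ Tᶜ, if G.Adj x y then (1 : ℝ) else 0 := by
          refine Finset.sum_congr rfl fun x hx => ?_
          symm
          refine Finset.sum_subset (Finset.subset_univ _) fun y _ hy => if_neg fun hadj => ?_
          rw [Finset.mem_compl, not_not, hT, Finset.mem_filter] at hy
          rw [hT, Finset.mem_filter] at hx
          exact hcon x y hadj hx.2 hy.2
      _ = ∑ y ∈ Tᶜ, ∑ x ∈ T, if G.Adj y x then (1 : ℝ) else 0 := by
          rw [Finset.sum_comm]
          simp only [G.adj_comm]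
      _ ≤ ∑ y ∈ Tᶜ, ∑ x, if G.Adj y x then (1 : ℝ) else 0 := by
          refine Finset.sum_le_sum fun y _ => ?_
          refine Finset.sum_le_sum_of_subset_of_nonneg (Finset.subset_univ _) fun x _ _ => ?_
          split_ifs <;> norm_num
      _ = bb 0 * Tᶜ.card := by
          rw [Finset.sum_congr rfl fun x _ => h.1.degree_eq x, Finset.sum_const, nsmul_eq_mul,
            mul_comm]
  have h5 : T.card ≤ Tᶜ.card := by exact_mod_cast le_of_mul_le_mul_left h4 hk
  rw [Finset.card_compl] at h5
  omega

/-- If `y` lies on exactly `[D]` lines, then exactly `1 + b` of them contain a neighbour of a given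
point at distance two from `y`. -/
theorem card_linesThrough_meeting (hL : IsLineFamily G L)
    (h : HasClassicalParams G D b α β cc aa bb) (hb : 2 ≤ b) (hD : 2 ≤ D) {x y : V}
    (hxy : G.dist x y = 2) (hy : ((linesThrough L y).card : ℝ) = gauss b D) :
    (((linesThrough L y).filter fun m => ∃ z ∈ m, G.Adj x z).card : ℝ) = 1 + b := by
  have hnadj : ¬ G.Adj x y := fun e => by
    rw [dist_eq_one_iff_adj.2 e] at hxy
    omega
  have hne : x ≠ y := fun e => by
    rw [e, dist_self] at hxy
    omega
  have hα := h.one_add_pos hb (i := 1) hD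
  rw [gauss_one, mul_one] at hα
  have hc := h.cc_eq (i := 1) hD
  rw [← (h.1.2.2.2 2 hD x y hxy).1, gauss_one, gauss_two, mul_one] at hc
  have h1 : ({z | G.Adj y z ∧ G.dist x z = 2 - 1}.ncard : ℝ) =
      ∑ z, if G.Adj y z then (if G.Adj x z then (1 : ℝ) else 0) else 0 := by
    rw [ncard_setOf_eq_sum]
    refine Finset.sum_congr rfl fun z _ => ?_
    simp [dist_eq_one_iff_adj, ite_and]
  have h2 : ∀ m ∈ linesThrough L y, (∑ z ∈ m.erase y, if G.Adj x z then (1 : ℝ) else 0) =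
      if ∃ z ∈ m, G.Adj x z then 1 + α else 0 := by
    intro m hm
    obtain ⟨hm, hym⟩ := mem_linesThrough.1 hm
    split_ifs with hex
    · rw [← h.card_adj_delsarte hb hD (hL.isClique m hm)
        (hL.card_eq_of_card_linesThrough_eq h hb (by omega) hy hm hym)
        (fun hxm => hnadj (hL.isClique m hm hxm hym hne)) hex,
        Finset.sum_erase (f := fun z => if G.Adj x z then (1 : ℝ) else 0) m (if_neg hnadj)]
      simp
    · push Not at hex
      exact Finset.sum_eq_zero fun z hz => if_neg (hex z (Finset.mem_of_mem_erase hz))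
  rw [h1, hL.sum_adj, Finset.sum_congr rfl h2, ← Finset.sum_filter, Finset.sum_const,
    nsmul_eq_mul] at hc
  exact mul_right_cancel₀ hα.ne' hc

theorem exists_nat_params (hL : IsLineFamily G L)
    (h : HasClassicalParams G D b α β cc aa bb) (hb : 2 ≤ b) (hD : 2 ≤ D) {y w : V}
    (hyw : G.Adj y w) (hy : ((linesThrough L y).card : ℝ) = gauss b D)
    (hw : ((linesThrough L w).card : ℝ) = gauss b D) :
    (∃ n : ℕ, α = n ∧ n ≤ b) ∧ ∃ m : ℕ, 0 < m ∧ β = m := by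
  obtain ⟨m, ⟨hm, hym, hwm⟩, -⟩ := hL.existsUnique y w hyw
  obtain ⟨ℓ, hℓ, hℓm⟩ : ∃ ℓ ∈ linesThrough L w, ℓ ≠ m := by
    refine Finset.exists_mem_ne ?_ m
    have h1 : gauss b 2 ≤ gauss b D := (gauss_strictMono hb).monotone hD
    have h2 : (2 : ℝ) ≤ b := by exact_mod_cast hb
    rw [gauss_two, ← hw] at h1
    have : (1 : ℝ) < (linesThrough L w).card := by linarith
    exact_mod_cast this
  obtain ⟨hℓ, hwℓ⟩ := mem_linesThrough.1 hℓ
  have hyℓ : y ∉ ℓ := fun hyℓ => hℓm (hL.eq_of_mem hyw.ne hℓ hm hyℓ hwℓ hym hwm)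
  have hcard := hL.card_eq_of_card_linesThrough_eq h hb (by omega) hw hℓ hwℓ
  have hf := h.card_adj_delsarte hb hD (hL.isClique ℓ hℓ) hcard hyℓ ⟨w, hwℓ, hyw⟩
  have hβ := h.beta_pos hb (by omega)
  have hαβ := h.beta_sub_pos hb (i := 1) hD
  rw [gauss_one, mul_one] at hαβ
  set N := ℓ.filter fun z => G.Adj y z with hN
  have hNpos : 0 < N.card := Finset.card_pos.2 ⟨w, by simp [hN, hwℓ, hyw]⟩
  obtain ⟨n, hn⟩ : ∃ n, N.card = n + 1 := ⟨N.card - 1, by omega⟩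
  have hαn : α = n := by
    rw [hn] at hf
    push_cast at hf
    linarith
  have hℓpos : 0 < ℓ.card := Finset.card_pos.2 ⟨w, hwℓ⟩
  obtain ⟨q, hq⟩ : ∃ q, ℓ.card = q + 1 := ⟨ℓ.card - 1, by omega⟩
  have hβq : β = q := by
    rw [hq] at hcard
    push_cast at hcard
    linarith
  refine ⟨⟨n, hαn, ?_⟩, q, by exact_mod_cast hβq ▸ hβ, hβq⟩
  obtain ⟨x, hxℓ, hxN⟩ : ∃ x ∈ ℓ, x ∉ N := by
    refine Finset.exists_mem_notMem_of_card_lt_card ?_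
    have : (N.card : ℝ) < ℓ.card := by linarith
    exact_mod_cast this
  have hyx : ¬ G.Adj y x := fun e => hxN (by simp [hN, hxℓ, e])
  have hxy : G.dist x y = 2 := by
    have h1 := h.1.1.one_lt_dist_of_ne_of_not_adj (u := x) (v := y)
      (fun e => hyℓ (e ▸ hxℓ)) fun e => hyx e.symm
    have h2 := h.1.1.dist_triangle (u := x) (v := w) (w := y)
    rw [dist_eq_one_iff_adj.2 hyw.symm, dist_eq_one_iff_adj.2
      (hL.isClique ℓ hℓ hxℓ hwℓ fun e => hyx (e ▸ hyw))] at h2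
    omega
  have hQ := hL.card_linesThrough_meeting h hb hD hxy hy
  set Q := (linesThrough L y).filter fun m => ∃ z ∈ m, G.Adj x z with hQdef
  have hline : ∀ z : V, ∃ m, G.Adj y z → m ∈ L ∧ y ∈ m ∧ z ∈ m := by
    intro z
    by_cases hz : G.Adj y z
    · obtain ⟨m, hm, -⟩ := hL.existsUnique y z hz
      exact ⟨m, fun _ => hm⟩
    · exact ⟨∅, fun e => absurd e hz⟩
  choose line hline using hline
  have hle : N.card ≤ Q.card := by
    refine Finset.card_le_card_of_injOn line ?_ ?_
    · intro z hz
      obtain ⟨hzℓ, hyz⟩ := Finset.mem_filter.1 hz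
      obtain ⟨h1, h2, h3⟩ := hline z hyz
      refine Finset.mem_filter.2 ⟨mem_linesThrough.2 ⟨h1, h2⟩, z, h3, ?_⟩
      exact hL.isClique ℓ hℓ hxℓ hzℓ fun e => hyx (e ▸ hyz)
    · intro z hz z' hz' heq
      obtain ⟨hzℓ, hyz⟩ := Finset.mem_filter.1 hz
      obtain ⟨hzℓ', hyz'⟩ := Finset.mem_filter.1 hz'
      by_contra hne
      obtain ⟨h1, h2, h3⟩ := hline z hyz
      obtain ⟨-, -, h3'⟩ := hline z' hyz'
      rw [← heq] at h3'
      exact hyℓ (hL.eq_of_mem hne h1 hℓ h3 h3' hzℓ hzℓ' ▸ h2)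
  have hQ' : Q.card = 1 + b := by exact_mod_cast hQ
  omega

end IsLineFamily

theorem HasClassicalParams.three_le_cc_two [Fintype V]
    (h : HasClassicalParams G D b α β cc aa bb) (hb : 2 ≤ b) (hD : 3 ≤ D) : 3 ≤ cc 2 := by
  have h1 := h.one_add_pos hb (i := 2) hD
  have h2 := h.cc_eq (i := 1) (by omega)
  rw [gauss_two] at h1
  rw [gauss_one, gauss_two] at h2
  have h3 : (b : ℝ) < cc 2 := by linarith
  have h4 : b < cc 2 := by exact_mod_cast h3
  omega

variable [Fintype V]

/-- A set of sets of vertices, as a finset of finsets. -/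
noncomputable def lineFinset (𝓛 : Set (Set V)) : Finset (Finset V) :=
  Finset.univ.filter fun ℓ => (ℓ : Set V) ∈ 𝓛

theorem mem_lineFinset {𝓛 : Set (Set V)} {ℓ : Finset V} :
    ℓ ∈ lineFinset 𝓛 ↔ (ℓ : Set V) ∈ 𝓛 := by
  simp [lineFinset]

theorem IsPointGraphOf.isLineFamily {a c : ℕ} (h : IsPointGraphOf G (splsLines G a c s)) :
    IsLineFamily G (lineFinset (splsLines G a c s)) where
  isClique ℓ hℓ := (mem_lineFinset.1 hℓ).1.1
  existsUnique x y hxy := by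
    obtain ⟨ℓ, ⟨hℓ, hx, hy⟩, huniq⟩ := h x y hxy
    refine ⟨ℓ.toFinset, ⟨mem_lineFinset.2 (by simpa using hℓ), by simpa, by simpa⟩, ?_⟩
    rintro m ⟨hm, hxm, hym⟩
    rw [← huniq m ⟨mem_lineFinset.1 hm, hxm, hym⟩]
    simp

theorem card_linesThrough_lineFinset_le {𝓛 : Set (Set V)}
    (h : ∀ x : V, {ℓ ∈ 𝓛 | x ∈ ℓ}.ncard ≤ s) (x : V) :
    (linesThrough (lineFinset 𝓛) x).card ≤ s := by
  refine le_trans ?_ (h x)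
  rw [← Set.ncard_coe_finset]
  refine Set.ncard_le_ncard_of_injOn (fun ℓ : Finset V => (ℓ : Set V)) ?_ ?_
  · intro ℓ hℓ
    obtain ⟨h1, h2⟩ := mem_linesThrough.1 (Finset.mem_coe.1 hℓ)
    exact ⟨mem_lineFinset.1 h1, h2⟩
  · exact Finset.coe_injective.injOn

end Lines

/-- if `Γ` has classical parameters `(D, b, α, β)`, `b ≥ 2`, `D ≥ 3`, and the
SPLS(s) property, then `s ≥ r = [D]`, `α` is an integer with `0 ≤ α ≤ b`, and `β` is a
positive integer. -/
theorem statement_6 {V : Type*} [Fintype V] (G : SimpleGraph V) (D b : ℕ) (α β : ℝ)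
    (cc aa bb : ℕ → ℕ) (hb : 2 ≤ b) (hD : 3 ≤ D)
    (h : HasClassicalParams G D b α β cc aa bb)
    (s : ℕ) (hs : 1 ≤ s) (hspls : HasSPLS G (aa 1) (cc 2) s) :
    gauss b D ≤ (s : ℝ) ∧ (∃ n : ℕ, α = n ∧ n ≤ b) ∧ (∃ m : ℕ, 0 < m ∧ β = m) := by
  obtain ⟨-, -, ha1, hpt, hcard, -⟩ := hspls
  have hc2 := h.three_le_cc_two hb hD
  have hL := hpt.isLineFamily
  have hs' := card_linesThrough_lineFinset_le hcard
  have hmin : ∀ ℓ ∈ lineFinset (splsLines G (aa 1) (cc 2) s), 2 * s < ℓ.card := by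
    intro ℓ hℓ
    have h1 := (mem_lineFinset.1 hℓ).2
    rw [Set.ncard_coe_finset] at h1
    zify at hc2 hs ⊢
    nlinarith
  obtain ⟨y, w, hyw, hy, hw⟩ :=
    hL.exists_adj_card_linesThrough_eq h hb (by omega) hs' hmin
  refine ⟨?_, hL.exists_nat_params h hb (by omega) hyw hy hw⟩
  rw [← hy]
  exact_mod_cast hs' y
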